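/- arXiv:2410.00646 — 2 statements merged into one kernel-verified Lean document; each statement's English description precedes it below -/
import Mathlib

section
/- Let p > 3 be an odd prime and let C_p denote the number of quadruples (x,y,z,u) ∈ (F_p^×)⁴ with x + x⁻¹ + y + y⁻¹ + z + z⁻¹ + u + u⁻¹ = 0. Then C_p = p³ − 3p² + 3p − 3 + Σ_{γ ∈ F_p \ {0,1,−1}} a_p(γ²)², where a_p(λ) := −Σ_{x ∈ F_p} φ(x(x−1)(x−λ)). -/
open Finset

open scoped Classical in
/-- The quadratic character of `F_p`, with `φ(0) = 0`. -/
noncomputable def phi (p : ℕ) (a : ZMod p) : ℤ :=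
  if a = 0 then 0 else if IsSquare a then 1 else -1

/-- The trace of Frobenius of the Legendre elliptic curve `y² = x(x−1)(x−λ)`:
`a_p(λ) = −Σ_{x ∈ F_p} φ(x(x−1)(x−λ))`. -/
noncomputable def ap (p : ℕ) [NeZero p] (l : ZMod p) : ℤ :=
  -∑ x : ZMod p, phi p (x * (x - 1) * (x - l))

/-- The number of points `(x,y,z,u) ∈ (F_p^×)⁴` on the Calabi–Yau threefold
`x + x⁻¹ + y + y⁻¹ + z + z⁻¹ + u + u⁻¹ = 0`. -/
def CY (p : ℕ) [NeZero p] : ℕ :=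
  (Finset.univ.filter (fun t : ZMod p × ZMod p × ZMod p × ZMod p =>
      t.1 ≠ 0 ∧ t.2.1 ≠ 0 ∧ t.2.2.1 ≠ 0 ∧ t.2.2.2 ≠ 0 ∧
      t.1 + t.1⁻¹ + t.2.1 + t.2.1⁻¹ + t.2.2.1 + t.2.2.1⁻¹ + t.2.2.2 + t.2.2.2⁻¹ = 0)).card

lemma four_ne_zero_of_ringChar_ne_two {F : Type*} [Field F]
    (hF : ringChar F ≠ 2) : (4 : F) ≠ 0 := by
  rw [show (4 : F) = 2 * 2 by norm_num]
  exact mul_ne_zero (Ring.two_ne_zero hF) (Ring.two_ne_zero hF)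

section QuadraticCharacterSums

variable {F : Type*} [Field F] [Fintype F] [DecidableEq F]

lemma quadraticChar_mul_sq (a : F) {b : F} (hb : b ≠ 0) :
    quadraticChar F (a * b ^ 2) = quadraticChar F a := by
  rw [map_mul, quadraticChar_sq_one' hb, mul_one]

/-- Summing a function of `v ^ 2` over a finite field of odd characteristic. -/
lemma sum_comp_sq (hF : ringChar F ≠ 2) (g : F → ℤ) :
    ∑ v : F, g (v ^ 2) = ∑ w : F, g w + ∑ w : F, quadraticChar F w * g w := by
  rw [← sum_add_distrib, ← sum_fiberwise (s := univ) (g := fun v : F => v ^ 2)]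
  refine sum_congr rfl fun w _ => ?_
  rw [sum_congr rfl (g := fun _ => g w) fun v hv => by rw [(mem_filter.mp hv).2], sum_const,
    nsmul_eq_mul]
  have h := quadraticChar_card_sqrts hF w
  rw [show {x : F | x ^ 2 = w}.toFinset = univ.filter (fun v : F => v ^ 2 = w) by ext; simp] at h
  rw [h]
  ring

lemma sum_quadraticChar_mul_one_sub (hF : ringChar F ≠ 2) :
    ∑ t : F, quadraticChar F (t * (1 - t)) = -quadraticChar F (-1) := by
  have h := jacobiSum_nontrivial_inv (quadraticChar_ne_one hF)
  rw [(quadraticChar_isQuadratic F).inv] at h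
  rw [← h, jacobiSum]
  simp only [map_mul]

/-- The character sum of a product of two non-proportional, non-constant linear factors. -/
lemma sum_quadraticChar_mul_linear (hF : ringChar F ≠ 2) {a b c d : F} (hb : b ≠ 0) (hd : d ≠ 0)
    (h : a * d - b * c ≠ 0) :
    ∑ w : F, quadraticChar F ((a - b * w) * (c - d * w)) = -quadraticChar F (b * d) := by
  have hr : c / d - a / b ≠ 0 := by
    rw [div_sub_div _ _ hd hb]
    exact div_ne_zero (fun h' => h (by linear_combination -h')) (mul_ne_zero hd hb)
  rw [← ((Equiv.mulLeft₀ _ hr).trans (Equiv.addLeft (a / b))).sum_comp]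
  have key (t : F) : (a - b * (a / b + (c / d - a / b) * t)) *
      (c - d * (a / b + (c / d - a / b) * t)) =
      (-1) * (b * d) * (t * (1 - t)) * (c / d - a / b) ^ 2 := by
    field_simp
    ring
  simp only [Equiv.trans_apply, Equiv.mulLeft₀_apply, Equiv.coe_addLeft, key,
    quadraticChar_mul_sq _ hr]
  simp only [map_mul _ (-1 * (b * d)), ← mul_sum, sum_quadraticChar_mul_one_sub hF]
  rw [map_mul]
  linear_combination (-quadraticChar F (b * d)) *
    quadraticChar_sq_one (neg_ne_zero.mpr (one_ne_zero (α := F)))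

/-- The number of nonzero `x` with `x + x⁻¹ = w`. -/
lemma card_add_inv_eq (hF : ringChar F ≠ 2) (w : F) :
    ((univ.filter fun x : F => x ≠ 0 ∧ x + x⁻¹ = w).card : ℤ) =
      quadraticChar F (w ^ 2 - 4) + 1 := by
  have h2 : (2 : F) ≠ 0 := Ring.two_ne_zero hF
  rw [← quadraticChar_card_sqrts hF]
  congr 1
  refine card_bij' (fun x _ => 2 * x - w) (fun z _ => (z + w) / 2) ?_ ?_ ?_ ?_
  · intro x hx
    obtain ⟨h0, h⟩ := (mem_filter.mp hx).2
    simp only [Set.mem_toFinset, Set.mem_ofPred_eq]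
    rw [← h]
    field_simp
    ring
  · intro z hz
    simp only [Set.mem_toFinset, Set.mem_ofPred_eq] at hz
    have h1 : (z + w) / 2 * (w - (z + w) / 2) = 1 := by
      have h4 : (4 : F) ≠ 0 := four_ne_zero_of_ringChar_ne_two hF
      refine mul_left_cancel₀ h4 ?_
      field_simp
      linear_combination -hz
    refine mem_filter.mpr ⟨mem_univ _, left_ne_zero_of_mul_eq_one h1, ?_⟩
    rw [inv_eq_of_mul_eq_one_right h1]
    ring
  · intro x _
    field_simp
    ring
  · intro z _
    field_simp
    ring

/-- The Cayley transform `v ↦ (1 + v) / (1 - v)` as a change of variable. -/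
lemma sum_ne_zero_cayley (hF : ringChar F ≠ 2) (g : F → ℤ) :
    ∑ y ∈ univ.filter (fun y : F => y ≠ 0), g y =
      g (-1) + ∑ v ∈ univ.filter (fun v : F => v ≠ 1 ∧ v ≠ -1), g ((1 + v) / (1 - v)) := by
  have h2 : (2 : F) ≠ 0 := Ring.two_ne_zero hF
  rw [← add_sum_erase _ g (a := -1) (by simp)]
  congr 1
  refine sum_bij' (fun y _ => (y - 1) / (y + 1)) (fun v _ => (1 + v) / (1 - v)) ?_ ?_ ?_ ?_ ?_
  · intro y hy
    simp only [mem_erase, mem_filter, mem_univ, true_and] at hy ⊢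
    have hy1 : y + 1 ≠ 0 := fun h => hy.1 (eq_neg_of_add_eq_zero_left h)
    refine ⟨fun h => h2 ?_, fun h => hy.2 ?_⟩
    · rw [div_eq_iff hy1] at h
      linear_combination -h
    · rw [div_eq_iff hy1] at h
      exact (mul_eq_zero.mp (by linear_combination h : (2 : F) * y = 0)).resolve_left h2
  · intro v hv
    simp only [mem_erase, mem_filter, mem_univ, true_and] at hv ⊢
    have hv1 : 1 - v ≠ 0 := sub_ne_zero.mpr hv.1.symm
    refine ⟨fun h => h2 ?_, div_ne_zero (fun h => hv.2 ?_) hv1⟩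
    · rw [div_eq_iff hv1] at h
      linear_combination h
    · linear_combination h
  · intro y hy
    simp only [mem_erase, mem_filter, mem_univ, true_and] at hy
    have hy1 : y + 1 ≠ 0 := fun h => hy.1 (eq_neg_of_add_eq_zero_left h)
    have : 1 - (y - 1) / (y + 1) = 2 / (y + 1) := by field_simp; ring
    rw [this]
    field_simp
    ring
  · intro v hv
    simp only [mem_filter, mem_univ, true_and] at hv
    have hv1 : 1 - v ≠ 0 := sub_ne_zero.mpr hv.1.symm
    have : (1 + v) / (1 - v) + 1 = 2 / (1 - v) := by field_simp; ring
    rw [this]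
    field_simp
    ring
  · intro y hy
    simp only [mem_erase, mem_filter, mem_univ, true_and] at hy
    have hy1 : y + 1 ≠ 0 := fun h => hy.1 (eq_neg_of_add_eq_zero_left h)
    have : 1 - (y - 1) / (y + 1) = 2 / (y + 1) := by field_simp; ring
    rw [this]
    congr 1
    field_simp
    ring

end QuadraticCharacterSums

section TorusCurve

variable {F : Type*} [Field F] [Fintype F] [DecidableEq F]

/-- The points of the curve `x + x⁻¹ + y + y⁻¹ = s` in the torus. -/
def torusCurve (s : F) : Finset (F × F) :=
  univ.filter fun t => t.1 ≠ 0 ∧ t.2 ≠ 0 ∧ t.1 + t.1⁻¹ + t.2 + t.2⁻¹ = s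

lemma card_torusCurve_neg (s : F) : (torusCurve (-s)).card = (torusCurve s).card := by
  refine card_equiv (Equiv.neg (F × F)) fun t => ?_
  simp only [torusCurve, mem_filter, mem_univ, true_and, Equiv.neg_apply, Prod.fst_neg,
    Prod.snd_neg, neg_ne_zero, inv_neg]
  refine and_congr_right fun _ => and_congr_right fun _ => ?_
  constructor <;> intro h <;> linear_combination -h

lemma card_filter_ne_zero : ((univ.filter fun x : F => x ≠ 0).card : ℤ) = Fintype.card F - 1 := by
  rw [filter_ne', card_erase_of_mem (mem_univ _), card_univ,
    Nat.cast_sub Fintype.card_pos, Nat.cast_one]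

lemma sum_card_torusCurve : ∑ s : F, ((torusCurve s).card : ℤ) = (Fintype.card F - 1 : ℤ) ^ 2 := by
  have h : torusCurve = fun s : F => (((univ.filter fun x : F => x ≠ 0) ×ˢ
      (univ.filter fun x : F => x ≠ 0)).filter fun t => t.1 + t.1⁻¹ + t.2 + t.2⁻¹ = s) := by
    ext s t
    simp [torusCurve, and_assoc]
  rw [h, ← Nat.cast_sum, ← card_eq_sum_card_fiberwise fun _ _ => mem_univ _, card_product,
    Nat.cast_mul, card_filter_ne_zero, sq]

lemma card_torusCurve_eq_sum (hF : ringChar F ≠ 2) (s : F) :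
    ((torusCurve s).card : ℤ) = Fintype.card F - 1 +
      ∑ y ∈ univ.filter (fun y : F => y ≠ 0), quadraticChar F ((s - y - y⁻¹) ^ 2 - 4) := by
  rw [← card_filter_ne_zero, ← nsmul_one (card (univ.filter _)), ← sum_const, ← sum_add_distrib,
    card_eq_sum_card_fiberwise (f := Prod.snd) (t := univ.filter fun y : F => y ≠ 0)
      (fun t ht => by simpa using (mem_filter.mp ht).2.2.1), Nat.cast_sum]
  refine sum_congr rfl fun y hy => ?_
  rw [add_comm, ← card_add_inv_eq hF]
  congr 1
  have hy0 := (mem_filter.mp hy).2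
  refine card_bij' (fun t _ => t.1) (fun x _ => (x, y)) ?_ ?_ ?_ ?_
  · rintro ⟨x, y'⟩ ht
    simp only [torusCurve, mem_filter, mem_univ, true_and] at ht ⊢
    obtain ⟨⟨hx, -, h⟩, rfl⟩ := ht
    exact ⟨hx, by linear_combination h⟩
  · intro x hx
    simp only [torusCurve, mem_filter, mem_univ, true_and] at hx ⊢
    exact ⟨⟨hx.1, hy0, by linear_combination hx.2⟩, trivial⟩
  · rintro ⟨x, y'⟩ ht
    simp only [mem_filter] at ht
    rw [ht.2]
  · intro x _
    rfl

/-- The character sum of the Legendre cubic. -/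
def legendreSum (l : F) : ℤ :=
  ∑ x : F, quadraticChar F (x * (x - 1) * (x - l))

/-- The change of variable turning the quartic model of the curve into the Legendre form. -/
lemma sum_cubic_eq_legendreSum {γ : F} (h0 : γ ≠ 0) (h1 : γ + 1 ≠ 0) :
    ∑ w : F, quadraticChar F (w * ((γ - 1 - γ * w) * (γ - (γ + 1) * w))) =
      quadraticChar F (-1) * legendreSum (γ ^ 2) := by
  have hc : -(1 / (γ * (γ + 1))) ≠ 0 := 
    neg_ne_zero.mpr (one_div_ne_zero (mul_ne_zero h0 h1))
  rw [← ((Equiv.mulLeft₀ _ hc).trans (Equiv.addLeft (γ / (γ + 1)))).sum_comp, legendreSum, mul_sum]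
  refine sum_congr rfl fun z _ => ?_
  rw [← map_mul, ← quadraticChar_mul_sq (-1 * _) (inv_ne_zero (mul_ne_zero h0 h1))]
  congr 1
  simp only [Equiv.trans_apply, Equiv.mulLeft₀_apply, Equiv.coe_addLeft]
  field_simp
  ring

lemma card_torusCurve (hF : ringChar F ≠ 2) {γ : F} (h0 : γ ≠ 0) (h1 : γ ≠ -1) :
    ((torusCurve (4 * γ)).card : ℤ) =
      Fintype.card F - 3 + quadraticChar F (-1) * legendreSum (γ ^ 2) := by
  have h4 : (4 : F) ≠ 0 := four_ne_zero_of_ringChar_ne_two hF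
  have h1' : γ + 1 ≠ 0 := fun h => h1 (eq_neg_of_add_eq_zero_left h)
  have hne : (-1 : F) ≠ 1 := Ring.neg_one_ne_one_of_char_ne_two hF
  rw [card_torusCurve_eq_sum hF, sum_ne_zero_cayley hF]
  have hA : quadraticChar F ((4 * γ - -1 - (-1)⁻¹) ^ 2 - 4) = quadraticChar F (γ * (γ + 1)) := by
    rw [← quadraticChar_mul_sq (γ * (γ + 1)) h4, inv_neg_one]
    congr 1
    ring
  set f : F → ℤ := fun w => quadraticChar F ((γ - 1 - γ * w) * (γ - (γ + 1) * w)) with hf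
  have hB : ∑ v ∈ univ.filter (fun v : F => v ≠ 1 ∧ v ≠ -1),
      quadraticChar F ((4 * γ - (1 + v) / (1 - v) - ((1 + v) / (1 - v))⁻¹) ^ 2 - 4) =
      ∑ v ∈ univ.filter (fun v : F => v ≠ 1 ∧ v ≠ -1), f (v ^ 2) := by
    refine sum_congr rfl fun v hv => ?_
    obtain ⟨hv1, hv2⟩ := (mem_filter.mp hv).2
    have hm : 1 - v ≠ 0 := sub_ne_zero.mpr hv1.symm
    have hp : 1 + v ≠ 0 := fun h => hv2 (by linear_combination h)
    simp only [hf]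
    rw [← quadraticChar_mul_sq (_ * (γ - (γ + 1) * v ^ 2)) (div_ne_zero h4 (mul_ne_zero hm hp))]
    congr 1
    field_simp
    ring
  have hC : ∑ v : F, f (v ^ 2) =
      2 + ∑ v ∈ univ.filter (fun v : F => v ≠ 1 ∧ v ≠ -1), f (v ^ 2) := by
    have hs : univ.filter (fun v : F => v ≠ 1 ∧ v ≠ -1) = (univ.erase 1).erase (-1) := by
      ext v
      simp [and_comm]
    have hf1 : f 1 = 1 := by simp [hf]
    rw [hs, ← add_sum_erase _ _ (mem_univ 1),
      ← add_sum_erase (univ.erase 1) _ (mem_erase.mpr ⟨hne, mem_univ _⟩), one_pow, neg_one_sq, hf1]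
    ring
  have hD := sum_comp_sq hF f
  have hE : ∑ w, f w = -quadraticChar F (γ * (γ + 1)) :=
    sum_quadraticChar_mul_linear hF h0 h1' (fun h => one_ne_zero (by linear_combination -h))
  have hG : ∑ w, quadraticChar F w * f w = quadraticChar F (-1) * legendreSum (γ ^ 2) := by
    rw [← sum_cubic_eq_legendreSum h0 h1']
    exact sum_congr rfl fun w _ => (map_mul _ _ _).symm
  rw [hA, hB]
  linarith

lemma legendreSum_one (hF : ringChar F ≠ 2) : legendreSum (1 : F) = -1 := by
  have h (x : F) : quadraticChar F (x * (x - 1) * (x - 1)) =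
      quadraticChar F x - if x = 1 then 1 else 0 := by
    split_ifs with hx
    · simp [hx]
    · rw [mul_assoc, ← sq, quadraticChar_mul_sq _ (sub_ne_zero.mpr hx), sub_zero]
  simp only [legendreSum, h, sum_sub_distrib, quadraticChar_sum_zero hF, sum_ite_eq', mem_univ,
    if_true, zero_sub]

lemma card_torusCurve_zero (hF : ringChar F ≠ 2) :
    ((torusCurve (0 : F)).card : ℤ) = 2 * Fintype.card F - 4 := by
  have h (y : F) (hy : y ∈ univ.filter fun y : F => y ≠ 0) :
      quadraticChar F ((0 - y - y⁻¹) ^ 2 - 4) =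
        1 - (if y = 1 then 1 else 0) - if y = -1 then 1 else 0 := by
    have hy0 := (mem_filter.mp hy).2
    have hne : (1 : F) ≠ -1 := (Ring.neg_one_ne_one_of_char_ne_two hF).symm
    rw [show (0 - y - y⁻¹) ^ 2 - 4 = (y - y⁻¹) ^ 2 by field_simp; ring]
    split_ifs with h1 h1' h1'
    · exact absurd (h1.symm.trans h1') hne
    · simp [h1]
    · simp [h1']
    · rw [quadraticChar_sq_one', sub_zero, sub_zero]
      intro h
      have : (y - 1) * (y + 1) = 0 := by
        field_simp at h
        linear_combination h
      rcases mul_eq_zero.mp this with h | h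
      · exact h1 (sub_eq_zero.mp h)
      · exact h1' (eq_neg_of_add_eq_zero_left h)
  rw [card_torusCurve_eq_sum hF, sum_congr rfl h, sum_sub_distrib, sum_sub_distrib, sum_const,
    nsmul_one, card_filter_ne_zero]
  simp
  ring

/-- Splitting off the three degenerate parameters `0, 1, -1`. -/
lemma sum_eq_add_sum_filter (hF : ringChar F ≠ 2) (g : F → ℤ) :
    ∑ s : F, g s = g 0 + g 1 + g (-1) +
      ∑ γ ∈ univ.filter (fun γ : F => γ ≠ 0 ∧ γ ≠ 1 ∧ γ ≠ -1), g γ := by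
  have hne : (-1 : F) ≠ 1 := Ring.neg_one_ne_one_of_char_ne_two hF
  have hs : univ.filter (fun v : F => v ≠ 0 ∧ v ≠ 1 ∧ v ≠ -1) =
      ((univ.erase 0).erase 1).erase (-1) := by
    ext v
    simp only [mem_filter, mem_univ, true_and, mem_erase, and_true]
    tauto
  rw [hs, ← add_sum_erase _ _ (mem_univ 0),
    ← add_sum_erase (univ.erase 0) _ (show (1 : F) ∈ _ by simp),
    ← add_sum_erase ((univ.erase 0).erase 1) _ (show (-1 : F) ∈ _ by simp [hne])]
  ring

/-- The second moment of the point counts of the curves `x + x⁻¹ + y + y⁻¹ = s`. -/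
lemma sum_card_torusCurve_sq (hF : ringChar F ≠ 2) :
    ∑ s : F, ((torusCurve s).card : ℤ) ^ 2 =
      (Fintype.card F : ℤ) ^ 3 - 3 * (Fintype.card F : ℤ) ^ 2 + 3 * (Fintype.card F : ℤ) - 3 +
        ∑ γ ∈ univ.filter (fun γ : F => γ ≠ 0 ∧ γ ≠ 1 ∧ γ ≠ -1), legendreSum (γ ^ 2) ^ 2 := by
  have h4 : (4 : F) ≠ 0 := four_ne_zero_of_ringChar_ne_two hF
  set q : ℤ := (Fintype.card F : ℤ)
  set ε := quadraticChar F (-1)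
  have hε : ε ^ 2 = 1 := quadraticChar_sq_one (neg_ne_zero.mpr one_ne_zero)
  set S := univ.filter (fun γ : F => γ ≠ 0 ∧ γ ≠ 1 ∧ γ ≠ -1)
  have hgen (γ : F) (hγ : γ ∈ S) :
      ((torusCurve (4 * γ)).card : ℤ) = q - 3 + ε * legendreSum (γ ^ 2) :=
    card_torusCurve hF (mem_filter.mp hγ).2.1 (mem_filter.mp hγ).2.2.2
  have hone : ((torusCurve (4 * 1 : F)).card : ℤ) = q - 3 - ε := by
    rw [card_torusCurve hF one_ne_zero (Ring.neg_one_ne_one_of_char_ne_two hF).symm, one_pow,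
      legendreSum_one hF]
    ring
  have hneg : ((torusCurve (4 * -1 : F)).card : ℤ) = q - 3 - ε := by
    rw [mul_neg, card_torusCurve_neg, hone]
  have hzero : ((torusCurve (4 * 0 : F)).card : ℤ) = 2 * q - 4 := by
    rw [mul_zero, card_torusCurve_zero hF]
  have hcard : (S.card : ℤ) = q - 3 := by
    have h := sum_eq_add_sum_filter hF fun _ => 1
    simp only [sum_const, nsmul_one, card_univ] at h
    linarith
  have hfirst := sum_card_torusCurve (F := F)
  rw [← Equiv.sum_comp (Equiv.mulLeft₀ _ h4), sum_eq_add_sum_filter hF] at hfirst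
  simp only [Equiv.mulLeft₀_apply] at hfirst
  rw [sum_congr rfl hgen, sum_add_distrib, sum_const, nsmul_eq_mul, hcard, ← mul_sum, hzero, hone,
    hneg] at hfirst
  rw [← Equiv.sum_comp (Equiv.mulLeft₀ _ h4), sum_eq_add_sum_filter hF]
  simp only [Equiv.mulLeft₀_apply]
  have hsq (γ : F) (hγ : γ ∈ S) : ((torusCurve (4 * γ)).card : ℤ) ^ 2 =
      (q - 3) ^ 2 + 2 * (q - 3) * (ε * legendreSum (γ ^ 2)) + legendreSum (γ ^ 2) ^ 2 := by
    rw [hgen γ hγ]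
    linear_combination legendreSum (γ ^ 2) ^ 2 * hε
  rw [sum_congr rfl hsq, sum_add_distrib, sum_add_distrib, sum_const, nsmul_eq_mul, hcard,
    ← mul_sum, ← mul_sum, hzero, hone, hneg]
  linear_combination 2 * (q - 3) * hfirst + 2 * hε

/-- Fibring the threefold over the common value of `x + x⁻¹ + y + y⁻¹` and
`-(z + z⁻¹ + u + u⁻¹)`. -/
lemma card_threefold_eq_sum :
    (univ.filter (fun t : F × F × F × F => t.1 ≠ 0 ∧ t.2.1 ≠ 0 ∧ t.2.2.1 ≠ 0 ∧ t.2.2.2 ≠ 0 ∧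
      t.1 + t.1⁻¹ + t.2.1 + t.2.1⁻¹ + t.2.2.1 + t.2.2.1⁻¹ + t.2.2.2 + t.2.2.2⁻¹ = 0)).card =
      ∑ s : F, (torusCurve s).card ^ 2 := by
  rw [card_eq_sum_card_fiberwise (f := fun t => t.1 + t.1⁻¹ + t.2.1 + t.2.1⁻¹) (t := univ)
    fun _ _ => mem_univ _]
  refine sum_congr rfl fun s _ => ?_
  rw [sq]
  nth_rewrite 2 [← card_torusCurve_neg]
  rw [← card_product]
  refine card_equiv (Equiv.prodAssoc F F (F × F)).symm fun t => ?_
  simp only [torusCurve, mem_filter, mem_univ, true_and, mem_product, Equiv.prodAssoc_symm_apply]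
  constructor
  · rintro ⟨⟨hx, hy, hz, hu, h⟩, hs⟩
    exact ⟨⟨hx, hy, hs⟩, hz, hu, by linear_combination h - hs⟩
  · rintro ⟨⟨hx, hy, hs⟩, hz, hu, h⟩
    exact ⟨⟨hx, hy, hz, hu, by linear_combination h + hs⟩, hs⟩

end TorusCurve

lemma phi_eq_quadraticChar (p : ℕ) [Fact p.Prime] (a : ZMod p) :
    phi p a = quadraticChar (ZMod p) a := by
  simp only [phi, quadraticChar_apply, quadraticCharFun]
  congr

lemma ap_eq_neg_legendreSum (p : ℕ) [Fact p.Prime] (l : ZMod p) :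
    ap p l = -legendreSum l := by
  simp only [ap, legendreSum, phi_eq_quadraticChar]

/-- `C_p = p³ − 3p² + 3p − 3 + Σ_{γ ∈ F_p∖{0,±1}} a_p(γ²)²`. -/
theorem calabi_yau_point_count_formula (p : ℕ) (hp : p.Prime) (h3 : 3 < p) :
    haveI : NeZero p := ⟨hp.ne_zero⟩
    (CY p : ℤ) = (p : ℤ) ^ 3 - 3 * (p : ℤ) ^ 2 + 3 * (p : ℤ) - 3 +
      ∑ γ ∈ Finset.univ.filter (fun γ : ZMod p => γ ≠ 0 ∧ γ ≠ 1 ∧ γ ≠ -1),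
        (ap p (γ ^ 2)) ^ 2 := by
  have : Fact p.Prime := ⟨hp⟩
  have hF : ringChar (ZMod p) ≠ 2 := by
    rw [ZMod.ringChar_zmod_n]
    omega
  have h := sum_card_torusCurve_sq hF
  rw [ZMod.card] at h
  simp only [ap_eq_neg_legendreSum, neg_sq]
  rw [← h, CY, card_threefold_eq_sum]
  push_cast
  rfl
end

section
/- Let p > 3 be an odd prime. Then the second twisted moment of Kloosterman sums satisfies S(2,φ)_p = Σ_{a ∈ F_p} φ(a)·K(a,p)² = −p. -/
open Finset

/-- The standard additive character of `ZMod p`: `θ(x) = e^{2πi x/p}`. -/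
noncomputable def theta (p : ℕ) (x : ZMod p) : ℂ :=
  Complex.exp (2 * Real.pi * Complex.I * (x.val : ℂ) / p)

/-- The classical Kloosterman sum `K(a,p) = Σ_{x ∈ F_p^×} θ(x + a x⁻¹)`. -/
noncomputable def Kl (p : ℕ) [NeZero p] (a : ZMod p) : ℂ :=
  ∑ x ∈ Finset.univ.filter (fun x : ZMod p => x ≠ 0), theta p (x + a * x⁻¹)

theorem MulChar.IsQuadratic.apply_mul_self {F R : Type*} [Field F] [CommRing R]
    {χ : MulChar F R} (hχ : χ.IsQuadratic) {a : F} (ha : a ≠ 0) : χ a * χ a = 1 := by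
  have h := congrArg (fun η : MulChar F R => η a) hχ.sq_eq_one
  simpa [sq, MulChar.one_apply ha.isUnit] using h

section TwistedMoment

variable {F R : Type*} [Field F] [Fintype F] [CommRing R]

theorem sum_filter_ne_zero_eq_sum_units [DecidableEq F] {M : Type*} [AddCommMonoid M]
    (f : F → M) : ∑ x ∈ univ.filter (fun x : F => x ≠ 0), f x = ∑ u : Fˣ, f u := by
  rw [← Finset.sum_subtype_eq_sum_filter, Finset.subtype_univ]
  exact (Fintype.sum_equiv unitsEquivNeZero _ _ fun _ => rfl).symm

theorem MulChar.sum_units_mul [DecidableEq F] (χ : MulChar F R) (f : F → R) :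
    ∑ u : Fˣ, χ u * f u = ∑ x, χ x * f x := by
  rw [← sum_filter_ne_zero_eq_sum_units (fun x => χ x * f x)]
  refine Finset.sum_filter_of_ne fun x _ hx h => hx ?_
  rw [h, MulChar.map_zero, zero_mul]

theorem gaussSum_mulShift_of_ne_one [IsDomain R] {χ : MulChar F R} (hχ : χ ≠ 1)
    (ψ : AddChar F R) (b : F) :
    ∑ a, χ a * ψ (a * b) = χ⁻¹ b * gaussSum χ ψ := by
  rcases eq_or_ne b 0 with rfl | hb
  · simp [MulChar.sum_eq_zero_of_ne_one hχ, MulChar.map_zero χ⁻¹]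
  · rw [← Units.val_mk0 hb, ← gaussSum_mulShift_eq]
    simp [gaussSum, AddChar.mulShift_apply, mul_comm]

theorem MulChar.IsQuadratic.sum_mul_sq_add_one [IsDomain R] {χ : MulChar F R} (hχ : χ ≠ 1)
    (hq : χ.IsQuadratic) : ∑ t, χ t * (χ (1 + t) * χ (1 + t)) = -χ (-1) := by
  classical
  have h (t : F) : χ t * (χ (1 + t) * χ (1 + t)) = χ t - if t = -1 then χ (-1) else 0 := by
    split_ifs with ht
    · simp [ht]
    · rw [hq.apply_mul_self fun h => ht (eq_neg_of_add_eq_zero_right h), mul_one, sub_zero]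
  simp [h, Finset.sum_sub_distrib, MulChar.sum_eq_zero_of_ne_one hχ]

/-- The second moment of the Kloosterman sums over a finite field, twisted by a nontrivial
quadratic character. -/
theorem sum_quadratic_mul_kloosterman_sq [DecidableEq F] [IsDomain R] {χ : MulChar F R}
    (hχ : χ ≠ 1) (hq : χ.IsQuadratic) {ψ : AddChar F R} (hψ : ψ.IsPrimitive) :
    ∑ a, χ a * (∑ x : Fˣ, ψ (x + a * (x : F)⁻¹)) ^ 2 = -(Fintype.card F : R) := by
  have key (x t : Fˣ) : χ⁻¹ ((x : F)⁻¹ + ((x * t : Fˣ) : F)⁻¹) = χ x * (χ t * χ (1 + t)) := by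
    have h : (x : F)⁻¹ + ((x * t : Fˣ) : F)⁻¹ = (x : F)⁻¹ * ((t : F)⁻¹ * (1 + t)) := by
      push_cast
      field_simp
      ring
    rw [h, map_mul, map_mul, ← MulChar.inv_apply', ← MulChar.inv_apply', inv_inv, hq.inv]
  calc ∑ a, χ a * (∑ x : Fˣ, ψ (x + a * (x : F)⁻¹)) ^ 2
      = ∑ x : Fˣ, ∑ y : Fˣ, ψ (x + y) * ∑ a, χ a * ψ (a * ((x : F)⁻¹ + (y : F)⁻¹)) := by
        simp_rw [sq, Finset.sum_mul_sum, Finset.mul_sum]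
        rw [Finset.sum_comm]
        refine Finset.sum_congr rfl fun x _ => ?_
        rw [Finset.sum_comm]
        refine Finset.sum_congr rfl fun y _ => Finset.sum_congr rfl fun a _ => ?_
        rw [← AddChar.map_add_eq_mul, mul_left_comm, ← AddChar.map_add_eq_mul]
        congr 2
        ring
    _ = ∑ x : Fˣ, ∑ t : Fˣ, ψ (x + (x * t : Fˣ)) *
          (χ x * (χ t * χ (1 + t)) * gaussSum χ ψ) := by
        refine Finset.sum_congr rfl fun x _ => ?_
        rw [← Equiv.sum_comp (Equiv.mulLeft x)]
        refine Finset.sum_congr rfl fun t _ => ?_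
        rw [gaussSum_mulShift_of_ne_one hχ, Equiv.coe_mulLeft, key]
    _ = ∑ t : Fˣ, χ t * (χ (1 + t) * gaussSum χ ψ * ∑ x : Fˣ, χ x * ψ (x * (1 + t))) := by
        rw [Finset.sum_comm]
        simp_rw [Finset.mul_sum]
        refine Finset.sum_congr rfl fun t _ => Finset.sum_congr rfl fun x _ => ?_
        rw [mul_add, mul_one, Units.val_mul]
        ring
    _ = gaussSum χ ψ ^ 2 * ∑ t, χ t * (χ (1 + t) * χ (1 + t)) := by
        rw [← MulChar.sum_units_mul χ (fun t => χ (1 + t) * χ (1 + t)), Finset.mul_sum]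
        refine Finset.sum_congr rfl fun t _ => ?_
        rw [MulChar.sum_units_mul χ (fun x => ψ (x * (1 + t))),
          gaussSum_mulShift_of_ne_one hχ, hq.inv]
        ring
    _ = -(Fintype.card F : R) := by
        rw [hq.sum_mul_sq_add_one hχ, gaussSum_sq hχ hq hψ]
        linear_combination (-(Fintype.card F : R)) *
          hq.apply_mul_self (neg_ne_zero.mpr (one_ne_zero (α := F)))

end TwistedMoment

theorem theta_eq_stdAddChar (p : ℕ) [NeZero p] (x : ZMod p) :
    theta p x = ZMod.stdAddChar x := by
  have h := ZMod.stdAddChar_coe (N := p) (x.val : ℤ)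
  rw [Int.cast_natCast, ZMod.natCast_zmod_val] at h
  rw [h, theta, Int.cast_natCast]

/-- `S(2,φ)_p = Σ_{a ∈ F_p} φ(a) K(a,p)² = −p`. -/
theorem second_twisted_moment (p : ℕ) (hp : p.Prime) (h3 : 3 < p) :
    haveI : NeZero p := ⟨hp.ne_zero⟩
    (∑ a : ZMod p, (phi p a : ℂ) * Kl p a ^ 2) = -(p : ℂ) := by
  have : NeZero p := ⟨hp.ne_zero⟩
  have : Fact p.Prime := ⟨hp⟩
  classical
  let χ : MulChar (ZMod p) ℂ := (quadraticChar (ZMod p)).ringHomComp (Int.castRingHom ℂ)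
  have hq : χ.IsQuadratic := (quadraticChar_isQuadratic (ZMod p)).comp _
  have hχ : χ ≠ 1 := (MulChar.ringHomComp_ne_one_iff (Int.cast_injective (α := ℂ))).mpr
    (quadraticChar_ne_one (by rw [ZMod.ringChar_zmod_n]; omega))
  have hphi (a : ZMod p) : (phi p a : ℂ) = χ a := by
    simp [χ, phi, quadraticChar_apply, quadraticCharFun]
  have h := sum_quadratic_mul_kloosterman_sq hχ hq (ZMod.isPrimitive_stdAddChar p)
  rw [ZMod.card] at h
  rw [← h]
  refine Finset.sum_congr rfl fun a _ => ?_
  rw [hphi, Kl, ← sum_filter_ne_zero_eq_sum_units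
    (fun x : ZMod p => ZMod.stdAddChar (x + a * x⁻¹))]
  simp_rw [theta_eq_stdAddChar]
end
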